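/- For every a ∈ ℂ, with c₀ = 1 and c_n = (∏_{k=0}^{n−1} (k² − a²)) / (n!)² for n ≥ 1, the series ∑_{n=0}^∞ c_n converges absolutely and its sum equals 1/(Γ(1−a) Γ(1+a)), where Γ is the complex Gamma function (and 1/Γ denotes its entire reciprocal). In particular, for a ∉ ℤ the sum equals sin(πa)/(πa). -/

import Mathlib

/-- The coefficients of the Gauss hypergeometric series `₂F₁(−a, a, 1; z)`:
`c₀ = 1` and `c_n = (∏_{k=0}^{n−1} (k² − a²)) / (n!)²` for `n ≥ 1`. -/
noncomputable def hgCoeff (a : ℂ) (n : ℕ) : ℂ :=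
  (∏ k ∈ Finset.range n, ((k : ℂ) ^ 2 - a ^ 2)) / ((Nat.factorial n : ℂ)) ^ 2

open Filter Topology in
/-- The partial products of Euler's sine product converge to the reciprocal Gamma product. -/
theorem tendsto_prod_one_sub_sq_div (a : ℂ) :
    Tendsto (fun n : ℕ => ∏ j ∈ Finset.range n, (1 - a ^ 2 / ((j : ℂ) + 1) ^ 2)) atTop
      (𝓝 (1 / (Complex.Gamma (1 - a) * Complex.Gamma (1 + a)))) := by
  rcases eq_or_ne a 0 with rfl | ha
  · simp
  have hpi : (Real.pi : ℂ) ≠ 0 := Complex.ofReal_ne_zero.mpr Real.pi_ne_zero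
  have hG : 1 / (Complex.Gamma (1 - a) * Complex.Gamma (1 + a))
      = (Real.pi * a)⁻¹ * Complex.sin (Real.pi * a) := by
    rw [add_comm 1 a, Complex.Gamma_add_one a ha,
      show Complex.Gamma (1 - a) * (a * Complex.Gamma a)
        = a * (Complex.Gamma a * Complex.Gamma (1 - a)) by ring,
      Complex.Gamma_mul_Gamma_one_sub, one_div, mul_inv, inv_div, mul_inv]
    ring
  rw [hG]
  refine ((Complex.tendsto_euler_sin_prod a).const_mul (Real.pi * a : ℂ)⁻¹).congr fun n => ?_
  rw [inv_mul_cancel_left₀ (mul_ne_zero hpi ha)]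

theorem hgCoeff_zero (a : ℂ) : hgCoeff a 0 = 1 := by simp [hgCoeff]

theorem hgCoeff_succ (a : ℂ) (n : ℕ) :
    hgCoeff a (n + 1) = -a ^ 2 / ((n : ℂ) + 1) ^ 2 *
      ∏ j ∈ Finset.range n, (1 - a ^ 2 / ((j : ℂ) + 1) ^ 2) := by
  induction n with
  | zero => simp [hgCoeff]
  | succ n ih =>
    have h1 : (n : ℂ) + 1 ≠ 0 := Nat.cast_add_one_ne_zero n
    have h2 : (n : ℂ) + 1 + 1 ≠ 0 := by exact_mod_cast Nat.cast_add_one_ne_zero (R := ℂ) (n + 1)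
    have hrec : hgCoeff a (n + 1 + 1)
        = hgCoeff a (n + 1) * ((((n : ℂ) + 1) ^ 2 - a ^ 2) / ((n : ℂ) + 1 + 1) ^ 2) := by
      rw [hgCoeff, hgCoeff, Finset.prod_range_succ _ (n + 1), Nat.factorial_succ (n + 1)]
      push_cast
      rw [div_mul_div_comm, mul_pow, mul_comm (((n : ℂ) + 1 + 1) ^ 2)]
    rw [hrec, ih, Finset.prod_range_succ]
    push_cast
    field_simp

theorem sum_range_succ_hgCoeff (a : ℂ) (n : ℕ) :
    ∑ k ∈ Finset.range (n + 1), hgCoeff a k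
      = ∏ j ∈ Finset.range n, (1 - a ^ 2 / ((j : ℂ) + 1) ^ 2) := by
  induction n with
  | zero => simp [hgCoeff_zero]
  | succ n ih =>
    rw [Finset.sum_range_succ, ih, hgCoeff_succ, Finset.prod_range_succ]
    ring

theorem summable_norm_hgCoeff (a : ℂ) : Summable (fun n : ℕ => ‖hgCoeff a n‖) := by
  obtain ⟨C, hC⟩ := (tendsto_prod_one_sub_sq_div a).norm.bddAbove_range
  rw [← summable_nat_add_iff 1]
  have hs : Summable (fun n : ℕ => ‖a‖ ^ 2 * C * (1 / ((n + 1 : ℕ) : ℝ) ^ 2)) :=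
    ((summable_nat_add_iff 1).mpr
      (Real.summable_one_div_nat_pow.mpr one_lt_two)).mul_left _
  refine hs.of_nonneg_of_le (fun _ => norm_nonneg _) fun n => ?_
  have hn : ‖(n : ℂ) + 1‖ = ((n + 1 : ℕ) : ℝ) := by
    rw [← Nat.cast_add_one, Complex.norm_natCast]
  rw [hgCoeff_succ, norm_mul, norm_div, norm_neg, norm_pow, norm_pow, hn]
  calc _ ≤ ‖a‖ ^ 2 / ((n + 1 : ℕ) : ℝ) ^ 2 * C := by
        gcongr
        exact hC ⟨n, rfl⟩
    _ = _ := by ring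

/-- Gauss's evaluation at `z = 1`: `∑_{n≥0} c_n = 1/(Γ(1−a)Γ(1+a))`, which by Euler
reflection equals `sin(πa)/(πa)` for `a ∉ ℤ`. -/
theorem hypergeometric_sum_at_one (a : ℂ) :
    Summable (fun n : ℕ => ‖hgCoeff a n‖) ∧
    ∑' n : ℕ, hgCoeff a n = 1 / (Complex.Gamma (1 - a) * Complex.Gamma (1 + a)) ∧
    ((∀ n : ℤ, a ≠ (n : ℂ)) →
      ∑' n : ℕ, hgCoeff a n = Complex.sin (Real.pi * a) / (Real.pi * a)) := by
  have hsum : ∑' n : ℕ, hgCoeff a n = 1 / (Complex.Gamma (1 - a) * Complex.Gamma (1 + a)) := by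
    refine tendsto_nhds_unique
      ((Filter.tendsto_add_atTop_iff_nat 1).mpr
        (summable_norm_hgCoeff a).of_norm.hasSum.tendsto_sum_nat) ?_
    simpa only [sum_range_succ_hgCoeff] using tendsto_prod_one_sub_sq_div a
  refine ⟨summable_norm_hgCoeff a, hsum, fun ha => ?_⟩
  have ha0 : a ≠ 0 := by simpa using ha 0
  rw [hsum, add_comm 1 a, Complex.Gamma_add_one a ha0, mul_left_comm, mul_comm (Complex.Gamma _),
    Complex.Gamma_mul_Gamma_one_sub, mul_div_assoc', one_div_div, mul_comm a]
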